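/- arXiv:1305.2889 — 3 statements merged into one kernel-verified Lean document; each statement's English description precedes it below -/
import Mathlib

section
/- Let d ≥ 1, let v, v* ∈ ℝ^d with v* ≠ v, and let u_1, …, u_j ∈ ℝ^d be points with u_i ≠ v for each i such that the vector v* − v is not a nonnegative multiple of u_i − v (i.e., ¬ SameRay ℝ (v* − v) (u_i − v)) for each i. Then the angular cell A = {x ∈ ℝ^d : for every i, angle(x − v, v* − v) < angle(x − v, u_i − v)} is an open set containing every point v + t·(v* − v) with t > 0; in particular, A has positive Lebesgue measure. -/
open MeasureTheory InnerProductGeometry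

theorem isOpen_setOf_angle_lt_angle {V : Type*} [NormedAddCommGroup V] [InnerProductSpace ℝ V]
    {a b : V} (ha : a ≠ 0) (hb : b ≠ 0) : IsOpen {y : V | angle y a < angle y b} := by
  refine isOpen_iff_mem_nhds.2 fun y hy => ?_
  have hy0 : y ≠ 0 := by
    rintro rfl
    simp at hy
  have hcont : ∀ c : V, c ≠ 0 → ContinuousAt (fun z : V => angle z c) y := fun c hc =>
    (continuousAt_angle (x := (y, c)) hy0 hc).comp (f := fun z : V => (z, c))
      (by fun_prop)
  exact (hcont a ha).eventually_lt (hcont b hb) hy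

theorem angle_pos_of_not_sameRay {V : Type*} [NormedAddCommGroup V] [InnerProductSpace ℝ V]
    {a b : V} (h : ¬ SameRay ℝ a b) : 0 < angle a b := by
  refine (angle_nonneg a b).lt_of_ne' fun h0 => h ?_
  obtain ⟨-, r, hr, rfl⟩ := angle_eq_zero_iff.1 h0
  exact SameRay.sameRay_pos_smul_right a hr

theorem angular_cell_open_contains_ray_pos_measure
    (d : ℕ) (hd : 1 ≤ d)
    (v vstar : EuclideanSpace ℝ (Fin d)) (hvs : vstar ≠ v)
    (j : ℕ) (u : Fin j → EuclideanSpace ℝ (Fin d))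
    (hu : ∀ i, u i ≠ v)
    (hray : ∀ i, ¬ SameRay ℝ (vstar - v) (u i - v)) :
    IsOpen {x : EuclideanSpace ℝ (Fin d) |
        ∀ i, angle (x - v) (vstar - v) < angle (x - v) (u i - v)} ∧
    (∀ t : ℝ, 0 < t →
      v + t • (vstar - v) ∈ {x : EuclideanSpace ℝ (Fin d) |
        ∀ i, angle (x - v) (vstar - v) < angle (x - v) (u i - v)}) ∧
    0 < volume {x : EuclideanSpace ℝ (Fin d) |
        ∀ i, angle (x - v) (vstar - v) < angle (x - v) (u i - v)} := by
  have hvs' : vstar - v ≠ 0 := sub_ne_zero.2 hvs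
  have hopen : IsOpen {x : EuclideanSpace ℝ (Fin d) |
      ∀ i, angle (x - v) (vstar - v) < angle (x - v) (u i - v)} := by
    rw [Set.ofPred_forall]
    exact isOpen_iInter_of_finite fun i =>
      (isOpen_setOf_angle_lt_angle hvs' (sub_ne_zero.2 (hu i))).preimage
        (f := fun x => x - v) (by fun_prop)
  have hmem : ∀ t : ℝ, 0 < t →
      v + t • (vstar - v) ∈ {x : EuclideanSpace ℝ (Fin d) |
        ∀ i, angle (x - v) (vstar - v) < angle (x - v) (u i - v)} := by
    intro t ht i
    rw [add_sub_cancel_left, angle_smul_left_of_pos _ _ ht, angle_smul_left_of_pos _ _ ht,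
      angle_self hvs']
    exact angle_pos_of_not_sameRay (hray i)
  exact ⟨hopen, hmem, hopen.measure_pos volume ⟨_, hmem 1 one_pos⟩⟩
end

section
/- Let d ≥ 1, let U ⊆ ℝ^d be a finite set of points with v ∈ U, let N ⊆ ℝ^d be a finite set (the neighbors of v), and let v* ∈ ℝ^d, such that the points are in general position: v* ≠ v, every u ∈ N satisfies u ≠ v, and for every u ∈ N the three points v, v*, u are not collinear. Then the intersection Vor(v) ∩ Vor'(v, v*) has positive Lebesgue measure, where Vor(v) = {x ∈ ℝ^d : for every u ∈ U with u ≠ v, dist(x, v) < dist(x, u)} and Vor'(v, v*) = {x ∈ ℝ^d : for every u ∈ N, angle(x − v, v* − v) < angle(x − v, u − v)}. -/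
open MeasureTheory InnerProductGeometry

open Filter Topology

theorem voronoi_inter_angular_cell_pos_measure
    (d : ℕ) (hd : 1 ≤ d)
    (U : Finset (EuclideanSpace ℝ (Fin d)))
    (v : EuclideanSpace ℝ (Fin d)) (hv : v ∈ U)
    (N : Finset (EuclideanSpace ℝ (Fin d)))
    (vstar : EuclideanSpace ℝ (Fin d))
    (hvs : vstar ≠ v)
    (hN : ∀ u ∈ N, u ≠ v)
    (hcol : ∀ u ∈ N, ¬ Collinear ℝ ({v, vstar, u} : Set (EuclideanSpace ℝ (Fin d)))) :
    0 < volume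
      ({x : EuclideanSpace ℝ (Fin d) |
          ∀ u ∈ U, u ≠ v → dist x v < dist x u} ∩
       {x : EuclideanSpace ℝ (Fin d) |
          ∀ u ∈ N, angle (x - v) (vstar - v) < angle (x - v) (u - v)}) := by
  have ha : vstar - v ≠ 0 := sub_ne_zero.mpr hvs
  obtain ⟨t, htU, ht⟩ : ∃ t : ℝ, (∀ u ∈ U, u ≠ v →
      dist (v + t • (vstar - v)) v < dist (v + t • (vstar - v)) u) ∧ 0 < t := by
    have hev : ∀ᶠ t : ℝ in 𝓝 0, ∀ u ∈ U, u ≠ v →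
        dist (v + t • (vstar - v)) v < dist (v + t • (vstar - v)) u := by
      rw [eventually_all_finset]
      intro u _
      rw [eventually_imp_distrib_left]
      intro huv
      refine ContinuousAt.eventually_lt (by fun_prop) (by fun_prop) ?_
      simpa using huv.symm
    exact ((hev.filter_mono nhdsWithin_le_nhds).and self_mem_nhdsWithin :
      ∀ᶠ t in 𝓝[>] (0 : ℝ), _).exists
  have hx : v + t • (vstar - v) - v = t • (vstar - v) := add_sub_cancel_left _ _
  have hx0 : v + t • (vstar - v) - v ≠ 0 := by rw [hx]; exact smul_ne_zero ht.ne' ha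
  refine Measure.measure_pos_of_mem_nhds volume (x := v + t • (vstar - v)) (inter_mem ?_ ?_)
  · refine (eventually_all_finset U).mpr fun u hu => eventually_imp_distrib_left.mpr fun huv => ?_
    exact ContinuousAt.eventually_lt (by fun_prop) (by fun_prop) (htU u hu huv)
  · refine (eventually_all_finset N).mpr fun u hu => ?_
    have hcont (b : EuclideanSpace ℝ (Fin d)) (hb : b ≠ 0) :
        ContinuousAt (fun x => angle (x - v) b) (v + t • (vstar - v)) :=
      ContinuousAt.comp (f := fun x => (x - v, b)) (continuousAt_angle hx0 hb) (by fun_prop)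
    refine (hcont _ ha).eventually_lt (hcont _ (sub_ne_zero.mpr (hN u hu))) ?_
    rw [hx, angle_smul_left_of_pos _ _ ht, angle_smul_left_of_pos _ _ ht, angle_self ha]
    refine (angle_nonneg _ _).lt_of_ne' fun h => hcol u hu ?_
    rw [Set.insert_comm]
    exact EuclideanGeometry.collinear_of_angle_eq_zero h
end

section
/- Let V be a nonempty finite type, let (Ω, ℱ, P) be a probability space with a filtration (ℱ_n)_{n ∈ ℕ}, and let U : ℕ → Ω → Finset V be a sequence of random finite subsets of V such that each U_n is ℱ_n-measurable and U_n(ω) ⊆ U_{n+1}(ω) for all n and ω. Suppose there exists p > 0 such that for every n, almost everywhere on the event {U_n ≠ Finset.univ}, the conditional expectation E[𝟙{U_{n+1} ≠ U_n} | ℱ_n] ≥ p. Then P(∃ n, U_n = Finset.univ) = 1. -/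
open MeasureTheory

/-- The event that two finitely valued random variables differ is measurable. -/
lemma measurableSet_ne_of_finite {Ω α : Type*} [Finite α] {m : MeasurableSpace Ω} {X Y : Ω → α}
    (hX : @Measurable Ω α m ⊤ X) (hY : @Measurable Ω α m ⊤ Y) :
    MeasurableSet {ω | X ω ≠ Y ω} := by
  have heq : {ω | X ω ≠ Y ω} = ⋃ a, X ⁻¹' {a} ∩ (Y ⁻¹' {a})ᶜ := by
    ext ω
    simp [eq_comm]
  rw [heq]
  exact MeasurableSet.iUnion fun a =>
    (hX (t := {a}) trivial).inter (hY (t := {a}) trivial).compl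

theorem drrt_reveals_all_vertices
    {V : Type*} [Fintype V] [Nonempty V] [DecidableEq V]
    {Ω : Type*} {m : MeasurableSpace Ω}
    (P : Measure Ω) [IsProbabilityMeasure P]
    (ℱ : Filtration ℕ m)
    (U : ℕ → Ω → Finset V)
    (hmeas : ∀ n, @Measurable Ω (Finset V) (ℱ n) ⊤ (U n))
    (hmono : ∀ n ω, U n ω ⊆ U (n + 1) ω)
    (p : ℝ) (hp : 0 < p)
    (h : ∀ n, ∀ᵐ ω ∂P, U n ω ≠ Finset.univ →
      p ≤ (P[({ω' | U (n + 1) ω' ≠ U n ω'}).indicator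
              (fun _ => (1 : ℝ)) | ℱ n]) ω) :
    P {ω | ∃ n, U n ω = Finset.univ} = 1 := by
  let s : ℕ → Set Ω := fun n => {ω | U n ω ≠ U (n - 1) ω}
  have hs : ∀ n, MeasurableSet[ℱ n] (s n) := fun n =>
    measurableSet_ne_of_finite (hmeas n) ((hmeas (n - 1)).mono (ℱ.mono (Nat.sub_le n 1)) le_rfl)
  suffices hae : ∀ᵐ ω ∂P, ∃ n, U n ω = Finset.univ by
    rw [measure_congr (Filter.eventuallyEq_univ.mpr hae), measure_univ]
  filter_upwards [ae_mem_limsup_atTop_iff P hs, ae_all_iff.mpr h] with ω hlim hω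
  by_contra! hne
  have hdiv : Filter.Tendsto (fun n => ∑ k ∈ Finset.range n,
      (P[(s (k + 1)).indicator (1 : Ω → ℝ) | ℱ k]) ω) Filter.atTop Filter.atTop := by
    refine Filter.tendsto_atTop_mono (fun n => ?_)
      (tendsto_natCast_atTop_atTop.atTop_mul_const hp)
    calc (n : ℝ) * p = ∑ _k ∈ Finset.range n, p := by simp
      _ ≤ _ := Finset.sum_le_sum fun k _ => hω k (hne k)
  have hfreq := Filter.mem_limsup_iff_frequently_mem.mp (hlim.mpr hdiv)
  obtain ⟨N, hN⟩ := WellFoundedGT.monotone_chain_condition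
    ⟨fun n => U n ω, monotone_nat_of_le_succ fun n => hmono n ω⟩
  obtain ⟨n, hn, hmem⟩ := Filter.frequently_atTop.mp hfreq (N + 1)
  exact hmem ((hN n (by omega)).symm.trans (hN (n - 1) (by omega)))
end
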